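/- Consider a DMC W with finite input alphabet X containing the 'off' symbol 0 and finite output alphabet Y, with Q0 = W(·|0) and supp(Q0) = Y. Suppose there exists a capacity-achieving input distribution whose support is all of X, and let Q* denote the capacity-achieving output distribution. Then L ≤ √( 2 · var_{Q0}( log( Q0(Y)/Q*(Y) ) ) ), where var_{Q0}(·) denotes the variance of the given function of Y when Y has distribution Q0. -/

import Mathlib

open Filter
open scoped BigOperators Topology

/-- `p` is a probability mass function on a finite type. -/
def IsDist {α : Type*} [Fintype α] (p : α → ℝ) : Prop :=
  (∀ a, 0 ≤ p a) ∧ ∑ a, p a = 1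

/-- Relative entropy (in nats) between pmfs on a finite type. -/
noncomputable def relEnt {α : Type*} [Fintype α] (p q : α → ℝ) : ℝ :=
  ∑ a, p a * Real.log (p a / q a)

/-- Output distribution on `Y` induced by input distribution `P` through channel `W`. -/
noncomputable def outDist {X Y : Type*} [Fintype X] (P : X → ℝ) (W : X → Y → ℝ) : Y → ℝ :=
  fun y => ∑ x, P x * W x y

/-- Mutual information `I(P, W)`. -/
noncomputable def mutInfo {X Y : Type*} [Fintype X] [Fintype Y] (P : X → ℝ) (W : X → Y → ℝ) : ℝ :=
  ∑ x, ∑ y, P x * W x y * Real.log (W x y / outDist P W y)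

/-- The output distribution on `Y^n` induced by a random code (a distribution `ρ` over
encoder/decoder pairs) together with a uniformly chosen message, through `n` memoryless
uses of the channel `W`. -/
noncomputable def codeOut {X Y : Type*} [Fintype X] [Fintype Y] [DecidableEq Y]
    (W : X → Y → ℝ) {n m : ℕ}
    (ρ : (Fin m → Fin n → X) × ((Fin n → Y) → Fin m) → ℝ) : (Fin n → Y) → ℝ :=
  fun ys => ∑ c, ρ c * ((m : ℝ)⁻¹ * ∑ j, ∏ i, W (c.1 j i) (ys i))

/-- Average probability of a decoding error of a random code, the message being uniform. -/
noncomputable def codeErr {X Y : Type*} [Fintype X] [Fintype Y] [DecidableEq Y]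
    (W : X → Y → ℝ) {n m : ℕ}
    (ρ : (Fin m → Fin n → X) × ((Fin n → Y) → Fin m) → ℝ) : ℝ :=
  ∑ c, ρ c * ((m : ℝ)⁻¹ * ∑ j, ∑ ys : Fin n → Y,
    if c.2 ys = j then 0 else ∏ i, W (c.1 j i) (ys i))

/-- `Kmax W x0 δ ε n` is the maximum of `log |M|` (in nats) over random codes of
blocklength `n` whose induced output distribution `Q^n` satisfies
`D(Q^n ‖ Q0^{×n}) ≤ δ` (with `Q0 = W(·|x0)`) and whose average error probability
is at most `ε`. -/
noncomputable def Kmax {X Y : Type*} [Fintype X] [Fintype Y] [DecidableEq Y]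
    (W : X → Y → ℝ) (x0 : X) (δ ε : ℝ) (n : ℕ) : ℝ :=
  sSup {k : ℝ | ∃ m : ℕ, 0 < m ∧
    ∃ ρ : (Fin m → Fin n → X) × ((Fin n → Y) → Fin m) → ℝ,
      (∀ c, 0 ≤ ρ c) ∧ (∑ c, ρ c) = 1 ∧
      relEnt (codeOut W ρ) (fun ys : Fin n → Y => ∏ i, W x0 (ys i)) ≤ δ ∧
      codeErr W ρ ≤ ε ∧ k = Real.log m}

/-- `IsL W x0 δ L` says that `L = lim_{ε↓0} liminf_{n→∞} K_n(δ,ε)/√(nδ)`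
(as an extended real, so that `L = ⊤` is allowed). -/
noncomputable def IsL {X Y : Type*} [Fintype X] [Fintype Y] [DecidableEq Y]
    (W : X → Y → ℝ) (x0 : X) (δ : ℝ) (L : EReal) : Prop :=
  Tendsto (fun ε : ℝ =>
      liminf (fun n : ℕ => ((Kmax W x0 δ ε n / Real.sqrt (n * δ) : ℝ) : EReal)) atTop)
    (nhdsWithin 0 (Set.Ioi 0)) (nhds L)



/-- Variance of the function `f` of `Y` when `Y` has distribution `q` on a finite set. -/
noncomputable def varFin {α : Type*} [Fintype α] (q f : α → ℝ) : ℝ :=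
  ∑ a, q a * (f a - ∑ a', q a' * f a') ^ 2

/-- Gibbs' variational inequality, with `log` replaced by its linear upper bound. -/
theorem sum_mul_le_relEnt_add {α : Type*} [Fintype α] {p q : α → ℝ} (hp : IsDist p)
    (hq : ∀ a, 0 < q a) (h : α → ℝ) :
    ∑ a, p a * h a ≤ relEnt p q + ∑ a, q a * Real.exp (h a) - 1 := by
  have key : ∀ a, p a * h a ≤ p a * Real.log (p a / q a) + q a * Real.exp (h a) - p a := by
    intro a
    have hqe : 0 < q a * Real.exp (h a) := mul_pos (hq a) (Real.exp_pos _)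
    rcases (hp.1 a).eq_or_lt with h0 | h0
    · rw [← h0]
      linarith
    · have h1 := Real.log_le_sub_one_of_pos (div_pos hqe h0)
      rw [Real.log_div hqe.ne' h0.ne', Real.log_mul (hq a).ne' (Real.exp_ne_zero _),
        Real.log_exp] at h1
      have h2 := mul_le_mul_of_nonneg_left h1 h0.le
      have h3 : p a * (q a * Real.exp (h a) / p a - 1) = q a * Real.exp (h a) - p a := by
        field_simp
      rw [Real.log_div h0.ne' (hq a).ne']
      rw [h3] at h2
      linarith
  calc ∑ a, p a * h a
      ≤ ∑ a, (p a * Real.log (p a / q a) + q a * Real.exp (h a) - p a) :=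
        Finset.sum_le_sum fun a _ => key a
    _ = relEnt p q + ∑ a, q a * Real.exp (h a) - 1 := by
        rw [Finset.sum_sub_distrib, Finset.sum_add_distrib, hp.2, relEnt]

theorem relEnt_nonneg {α : Type*} [Fintype α] {p q : α → ℝ} (hp : IsDist p)
    (hq : IsDist q) (hq0 : ∀ a, 0 < q a) : 0 ≤ relEnt p q := by
  have h := sum_mul_le_relEnt_add hp hq0 fun _ => 0
  simp only [mul_zero, Finset.sum_const_zero, Real.exp_zero, mul_one, hq.2] at h
  linarith

theorem relEnt_eq_relEnt_add {α : Type*} [Fintype α] (p : α → ℝ) {q r : α → ℝ}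
    (hq : ∀ a, 0 < q a) (hr : ∀ a, 0 < r a) :
    relEnt p r = relEnt p q + ∑ a, p a * Real.log (q a / r a) := by
  rw [relEnt, relEnt, ← Finset.sum_add_distrib]
  refine Finset.sum_congr rfl fun a _ => ?_
  by_cases h0 : p a = 0
  · simp [h0]
  · rw [Real.log_div h0 (hr a).ne', Real.log_div h0 (hq a).ne',
      Real.log_div (hq a).ne' (hr a).ne']
    ring

section Channel

variable {X Y : Type*} [Fintype X] [Fintype Y]

theorem outDist_pos {P : X → ℝ} {W : X → Y → ℝ} {x0 : X} (hW : ∀ x, IsDist (W x))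
    (hsupp : ∀ y, 0 < W x0 y) (hP : IsDist P) (h0 : 0 < P x0) (y : Y) :
    0 < outDist P W y :=
  Finset.sum_pos' (fun x _ => mul_nonneg (hP.1 x) ((hW x).1 y))
    ⟨x0, Finset.mem_univ _, mul_pos h0 (hsupp y)⟩

theorem isDist_outDist {P : X → ℝ} {W : X → Y → ℝ} (hW : ∀ x, IsDist (W x))
    (hP : IsDist P) : IsDist (outDist P W) := by
  refine ⟨fun y => Finset.sum_nonneg fun x _ => mul_nonneg (hP.1 x) ((hW x).1 y), ?_⟩
  simp only [outDist]
  rw [Finset.sum_comm]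
  simp only [← Finset.mul_sum, (hW _).2, mul_one, hP.2]

theorem mutInfo_eq_sum_relEnt (P : X → ℝ) (W : X → Y → ℝ) :
    mutInfo P W = ∑ x, P x * relEnt (W x) (outDist P W) := by
  simp only [mutInfo, relEnt, Finset.mul_sum, mul_assoc]

/-- The compensation identity. -/
theorem sum_mul_relEnt_eq {P : X → ℝ} {W : X → Y → ℝ} {q : Y → ℝ}
    (hpos : ∀ y, 0 < outDist P W y) (hq : ∀ y, 0 < q y) :
    ∑ x, P x * relEnt (W x) q = mutInfo P W + relEnt (outDist P W) q := by
  have h : relEnt (outDist P W) q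
      = ∑ x, P x * ∑ y, W x y * Real.log (outDist P W y / q y) := by
    conv_lhs => rw [relEnt]
    simp only [Finset.mul_sum]
    rw [Finset.sum_comm]
    refine Finset.sum_congr rfl fun y _ => ?_
    conv_lhs => enter [1]; rw [outDist]
    rw [Finset.sum_mul]
    simp only [mul_assoc]
  rw [h, mutInfo_eq_sum_relEnt, ← Finset.sum_add_distrib]
  refine Finset.sum_congr rfl fun x _ => ?_
  rw [relEnt_eq_relEnt_add (W x) hpos hq]
  ring

/-- The Kuhn–Tucker condition: no input symbol exceeds the capacity. -/
theorem relEnt_le_mutInfo_of_forall_le {W : X → Y → ℝ} (hW : ∀ x, IsDist (W x))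
    {P : X → ℝ} (hP : IsDist P) (hpos : ∀ y, 0 < outDist P W y)
    (hcap : ∀ R : X → ℝ, IsDist R → mutInfo R W ≤ mutInfo P W) (x : X) :
    relEnt (W x) (outDist P W) ≤ mutInfo P W := by
  classical
  let R : ℝ → X → ℝ := fun l x' => (1 - l) * P x' + l * if x' = x then 1 else 0
  have hR : ∀ l ∈ Set.Ioo (0 : ℝ) 1, IsDist (R l) := by
    rintro l ⟨h0, h1⟩
    refine ⟨fun x' => ?_, ?_⟩
    · have : (0 : ℝ) ≤ if x' = x then 1 else 0 := by split_ifs <;> norm_num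
      exact add_nonneg (mul_nonneg (by linarith) (hP.1 x')) (mul_nonneg h0.le this)
    · simp only [R, Finset.sum_add_distrib, ← Finset.mul_sum, hP.2, Finset.sum_ite_eq',
        Finset.mem_univ, if_true]
      ring
  have hsplit : ∀ (l : ℝ) (F : X → ℝ),
      ∑ x', R l x' * F x' = (1 - l) * (∑ x', P x' * F x') + l * F x := by
    intro l F
    simp only [R, add_mul, Finset.sum_add_distrib, mul_assoc, ← Finset.mul_sum, ite_mul,
      one_mul, zero_mul, Finset.sum_ite_eq', Finset.mem_univ, if_true]
  have hout : ∀ l y, outDist (R l) W y = (1 - l) * outDist P W y + l * W x y :=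
    fun l y => hsplit l fun x' => W x' y
  have hle : ∀ l ∈ Set.Ioo (0 : ℝ) 1, relEnt (W x) (outDist (R l) W) ≤ mutInfo P W := by
    intro l hl
    have hlpos : ∀ y, 0 < outDist (R l) W y := fun y => by
      rw [hout]
      exact add_pos_of_pos_of_nonneg (mul_pos (by linarith [hl.2]) (hpos y))
        (mul_nonneg hl.1.le ((hW x).1 y))
    have h1 := hcap _ (hR l hl)
    rw [mutInfo_eq_sum_relEnt (R l), hsplit, sum_mul_relEnt_eq hpos hlpos] at h1
    have h2 := relEnt_nonneg (isDist_outDist hW hP) (isDist_outDist hW (hR l hl)) hlpos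
    have h3 : 0 ≤ (1 - l) * relEnt (outDist P W) (outDist (R l) W) :=
      mul_nonneg (by linarith [hl.2]) h2
    refine le_of_mul_le_mul_left ?_ hl.1
    linarith
  have hlim : Tendsto (fun l => relEnt (W x) (outDist (R l) W)) (𝓝[>] 0)
      (𝓝 (relEnt (W x) (outDist P W))) := by
    simp only [relEnt]
    refine tendsto_finsetSum _ fun y _ => ?_
    by_cases h0 : W x y = 0
    · simp [h0]
    refine Tendsto.const_mul _ (Tendsto.log ?_ (div_ne_zero h0 (hpos y).ne'))
    refine Tendsto.div tendsto_const_nhds ?_ (hpos y).ne'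
    refine tendsto_nhdsWithin_of_tendsto_nhds ?_
    have hc : Continuous fun l : ℝ => (1 - l) * outDist P W y + l * W x y := by fun_prop
    simp only [hout]
    simpa using hc.tendsto 0
  refine le_of_tendsto hlim ?_
  filter_upwards [Ioo_mem_nhdsGT (zero_lt_one' ℝ)] with l hl using hle l hl

/-- Under a capacity-achieving input distribution, all used symbols are equally informative. -/
theorem relEnt_eq_mutInfo_of_forall_le {W : X → Y → ℝ} (hW : ∀ x, IsDist (W x))
    {P : X → ℝ} (hP : IsDist P) (hpos : ∀ y, 0 < outDist P W y)
    (hcap : ∀ R : X → ℝ, IsDist R → mutInfo R W ≤ mutInfo P W) {x : X} (hx : 0 < P x) :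
    relEnt (W x) (outDist P W) = mutInfo P W := by
  have hle := relEnt_le_mutInfo_of_forall_le hW hP hpos hcap
  have hsum : ∑ x, P x * relEnt (W x) (outDist P W) = ∑ x, P x * mutInfo P W := by
    rw [← mutInfo_eq_sum_relEnt, ← Finset.sum_mul, hP.2, one_mul]
  have h := (Finset.sum_eq_sum_iff_of_le fun x _ =>
    mul_le_mul_of_nonneg_left (hle x) (hP.1 x)).1 hsum x (Finset.mem_univ x)
  exact mul_left_cancel₀ hx.ne' h

end Channel

section Product

variable {Y : Type*} [Fintype Y] {n : ℕ}

theorem sum_prod_apply (F : Fin n → Y → ℝ) :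
    ∑ ys : Fin n → Y, ∏ i, F i (ys i) = ∏ i, ∑ y, F i y := by
  classical
  rw [Finset.prod_univ_sum, Fintype.piFinset_univ]

theorem isDist_prod {p : Fin n → Y → ℝ} (hp : ∀ i, IsDist (p i)) :
    IsDist fun ys : Fin n → Y => ∏ i, p i (ys i) := by
  refine ⟨fun ys => Finset.prod_nonneg fun i _ => (hp i).1 _, ?_⟩
  rw [sum_prod_apply]
  exact Finset.prod_eq_one fun i _ => (hp i).2

theorem sum_prod_mul_apply {p : Fin n → Y → ℝ} (hp : ∀ i, IsDist (p i)) (k : Fin n)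
    (φ : Y → ℝ) :
    ∑ ys : Fin n → Y, (∏ i, p i (ys i)) * φ (ys k) = ∑ y, p k y * φ y := by
  have h : ∀ ys : Fin n → Y, (∏ i, p i (ys i)) * φ (ys k)
      = ∏ i, (p i (ys i) * if i = k then φ (ys i) else 1) := by
    intro ys
    rw [Finset.prod_mul_distrib]
    congr 1
    simp
  simp only [h]
  rw [sum_prod_apply fun i y => p i y * if i = k then φ y else 1]
  rw [Finset.prod_eq_single k]
  · simp
  · intro i _ hi
    simp [hi, (hp i).2]
  · simp

/-- If every letter satisfies `D(pᵢ ‖ q) = -E_{pᵢ} g`, so does the product. -/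
theorem relEnt_prod_eq {p : Fin n → Y → ℝ} (hp : ∀ i, IsDist (p i)) {q g : Y → ℝ}
    (hq : ∀ y, 0 < q y) (hg : ∀ i, relEnt (p i) q = -∑ y, p i y * g y) :
    relEnt (fun ys : Fin n → Y => ∏ i, p i (ys i)) (fun ys => ∏ i, q (ys i))
      = -∑ ys : Fin n → Y, (∏ i, p i (ys i)) * ∑ i, g (ys i) := by
  have h1 : relEnt (fun ys : Fin n → Y => ∏ i, p i (ys i)) (fun ys => ∏ i, q (ys i))
      = ∑ ys : Fin n → Y, ∑ k, (∏ i, p i (ys i)) * Real.log (p k (ys k) / q (ys k)) := by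
    refine Finset.sum_congr rfl fun ys _ => ?_
    dsimp only
    rw [← Finset.mul_sum]
    by_cases h0 : ∏ i, p i (ys i) = 0
    · simp [h0]
    · rw [← Finset.prod_div_distrib, Real.log_prod]
      intro i _
      exact div_ne_zero (Finset.prod_ne_zero_iff.1 h0 i (Finset.mem_univ i)) (hq _).ne'
  simp only [Finset.mul_sum]
  rw [h1, Finset.sum_comm]
  conv_rhs => rw [Finset.sum_comm, ← Finset.sum_neg_distrib]
  refine Finset.sum_congr rfl fun k _ => ?_
  rw [sum_prod_mul_apply hp k fun y => Real.log (p k y / q y), sum_prod_mul_apply hp k g]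
  exact hg k

theorem sum_prod_mul_exp_le_one {q u : Y → ℝ} (hq : ∀ y, 0 < q y)
    (hu : ∑ y, q y * Real.exp (u y) ≤ 1) :
    ∑ ys : Fin n → Y, (∏ i, q (ys i)) * Real.exp (∑ i, u (ys i)) ≤ 1 := by
  simp only [Real.exp_sum, ← Finset.prod_mul_distrib]
  rw [sum_prod_apply fun _ y => q y * Real.exp (u y)]
  exact Finset.prod_le_one
    (fun i _ => Finset.sum_nonneg fun y _ => mul_nonneg (hq y).le (Real.exp_pos _).le)
    fun i _ => hu

end Product

/-- Second-order bound on the moment generating function of a centered variable. -/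
theorem eventually_sum_mul_exp_le_one {Y : Type*} [Fintype Y] {q g : Y → ℝ}
    (hq : IsDist q) (hg : ∑ y, q y * g y = 0) {η : ℝ} (hη : 0 < η) :
    ∀ᶠ t : ℝ in 𝓝 0, ∑ y, q y *
      Real.exp (-(t * g y) - t ^ 2 * (∑ y, q y * g y ^ 2 + η) / 2) ≤ 1 := by
  have h1 : ∀ᶠ t : ℝ in 𝓝 0, ∀ y, |t * g y| ≤ 1 := by
    refine eventually_all.2 fun y => ?_
    have hc : Continuous fun t : ℝ => |t * g y| := by fun_prop
    refine (hc.tendsto 0).eventually (eventually_le_nhds ?_)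
    simp
  have h2 : ∀ᶠ t : ℝ in 𝓝 0, |t| * ∑ y, q y * |g y| ^ 3 < η / 2 := by
    have hc : Continuous fun t : ℝ => |t| * ∑ y, q y * |g y| ^ 3 := by fun_prop
    refine (hc.tendsto 0).eventually (eventually_lt_nhds ?_)
    simp only [abs_zero, zero_mul]
    positivity
  filter_upwards [h1, h2] with t h1 h2
  set V := ∑ y, q y * g y ^ 2
  have hexp : ∀ x : ℝ, |x| ≤ 1 → Real.exp x ≤ 1 + x + x ^ 2 / 2 + |x| ^ 3 := by
    intro x hx
    have h := Real.exp_bound hx (n := 3) (by norm_num)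
    norm_num [Finset.sum_range_succ, Nat.factorial] at h
    have h' := (abs_le.1 h).2
    have : 0 ≤ |x| ^ 3 := by positivity
    linarith
  have h3 : ∑ y, q y * Real.exp (-(t * g y)) ≤ 1 + t ^ 2 * (V + η) / 2 := by
    calc ∑ y, q y * Real.exp (-(t * g y))
        ≤ ∑ y, (q y - t * (q y * g y) + t ^ 2 / 2 * (q y * g y ^ 2)
            + t ^ 2 * |t| * (q y * |g y| ^ 3)) := by
          refine Finset.sum_le_sum fun y _ => ?_
          have h := mul_le_mul_of_nonneg_left
            (hexp (-(t * g y)) (by rw [abs_neg]; exact h1 y)) (hq.1 y)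
          refine h.trans (le_of_eq ?_)
          have ht : |t| ^ 3 = t ^ 2 * |t| := by rw [pow_succ, sq_abs]
          rw [abs_neg, abs_mul, mul_pow, ht]
          ring
      _ = 1 + t ^ 2 * V / 2 + t ^ 2 * (|t| * ∑ y, q y * |g y| ^ 3) := by
          simp only [Finset.sum_add_distrib, Finset.sum_sub_distrib, ← Finset.mul_sum,
            hq.2, hg]
          ring
      _ ≤ 1 + t ^ 2 * (V + η) / 2 := by
          nlinarith [mul_le_mul_of_nonneg_left h2.le (sq_nonneg t)]
  have h4 := Real.add_one_le_exp (t ^ 2 * (V + η) / 2)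
  simp only [Real.exp_sub, ← mul_div_assoc, ← Finset.sum_div]
  rw [div_le_one (Real.exp_pos _)]
  linarith

/-- A Fano-type inequality for a single deterministic code. -/
theorem log_mul_one_sub_le_relEnt {X Y : Type*} [Fintype Y] {n m : ℕ} {W : X → Y → ℝ} (hW : ∀ x, IsDist (W x)) (hm : 0 < m)
    {q : (Fin n → Y) → ℝ} (hq : IsDist q) (hq0 : ∀ ys, 0 < q ys)
    (c : (Fin m → Fin n → X) × ((Fin n → Y) → Fin m)) :
    Real.log m * (1 - (m : ℝ)⁻¹ * ∑ j, ∑ ys : Fin n → Y,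
        if c.2 ys = j then 0 else ∏ i, W (c.1 j i) (ys i))
      ≤ (m : ℝ)⁻¹ * ∑ j, relEnt (fun ys => ∏ i, W (c.1 j i) (ys i)) q + 1 := by
  have hm' : (0 : ℝ) < m := by positivity
  have key : ∀ j : Fin m,
      Real.log m * (1 - ∑ ys : Fin n → Y, if c.2 ys = j then 0 else ∏ i, W (c.1 j i) (ys i))
        ≤ relEnt (fun ys => ∏ i, W (c.1 j i) (ys i)) q
          + m * ∑ ys, if c.2 ys = j then q ys else 0 := by
    intro j
    have hd : IsDist fun ys : Fin n → Y => ∏ i, W (c.1 j i) (ys i) :=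
      isDist_prod fun i => hW (c.1 j i)
    have h := sum_mul_le_relEnt_add hd hq0 fun ys => if c.2 ys = j then Real.log m else 0
    have hl : ∑ ys : Fin n → Y, (∏ i, W (c.1 j i) (ys i)) *
          (if c.2 ys = j then Real.log m else 0)
        = Real.log m * (1 - ∑ ys : Fin n → Y,
            if c.2 ys = j then 0 else ∏ i, W (c.1 j i) (ys i)) := by
      rw [← hd.2, ← Finset.sum_sub_distrib, Finset.mul_sum]
      refine Finset.sum_congr rfl fun ys _ => ?_
      split_ifs <;> ring
    have hr : ∑ ys, q ys * Real.exp (if c.2 ys = j then Real.log m else 0)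
        ≤ 1 + m * ∑ ys, if c.2 ys = j then q ys else 0 := by
      rw [← hq.2, Finset.mul_sum, ← Finset.sum_add_distrib]
      refine Finset.sum_le_sum fun ys _ => ?_
      split_ifs
      · rw [Real.exp_log hm']
        linarith [hq.1 ys]
      · simp
    linarith
  have hsum := mul_le_mul_of_nonneg_left
    (Finset.sum_le_sum fun j (_ : j ∈ Finset.univ) => key j) (inv_nonneg.2 hm'.le)
  have hqs : ∑ j : Fin m, ∑ ys, (if c.2 ys = j then q ys else 0) = 1 := by
    rw [Finset.sum_comm]
    simpa using hq.2
  rw [← Finset.mul_sum, Finset.sum_sub_distrib, Finset.sum_add_distrib, ← Finset.mul_sum,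
    hqs] at hsum
  simp only [Finset.sum_const, Finset.card_univ, Fintype.card_fin, nsmul_eq_mul, mul_one]
    at hsum
  calc _ = (m : ℝ)⁻¹ * (Real.log m * ((m : ℝ) - ∑ j, ∑ ys : Fin n → Y,
        if c.2 ys = j then 0 else ∏ i, W (c.1 j i) (ys i))) := by
        field_simp
    _ ≤ _ := hsum
    _ = _ := by field_simp

section Code

variable {X Y : Type*} [Fintype X] [Fintype Y] [DecidableEq Y] {n m : ℕ}

theorem isDist_codeOut {W : X → Y → ℝ} (hW : ∀ x, IsDist (W x)) (hm : 0 < m)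
    {ρ : (Fin m → Fin n → X) × ((Fin n → Y) → Fin m) → ℝ} (hρ : IsDist ρ) :
    IsDist (codeOut W ρ) := by
  have hm' : (m : ℝ) ≠ 0 := by positivity
  refine ⟨fun ys => ?_, ?_⟩
  · exact Finset.sum_nonneg fun c _ => mul_nonneg (hρ.1 c) (mul_nonneg (by positivity)
      (Finset.sum_nonneg fun j _ => Finset.prod_nonneg fun i _ => (hW _).1 _))
  · simp only [codeOut]
    rw [Finset.sum_comm]
    simp only [← Finset.mul_sum]
    rw [← hρ.2]
    refine Finset.sum_congr rfl fun c _ => ?_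
    rw [Finset.sum_comm]
    simp only [(isDist_prod fun i => hW (c.1 _ i)).2]
    simp [hm']

theorem sum_codeOut_mul (W : X → Y → ℝ)
    (ρ : (Fin m → Fin n → X) × ((Fin n → Y) → Fin m) → ℝ) (h : (Fin n → Y) → ℝ) :
    ∑ ys, codeOut W ρ ys * h ys
      = ∑ c, ρ c * ((m : ℝ)⁻¹ * ∑ j, ∑ ys : Fin n → Y, (∏ i, W (c.1 j i) (ys i)) * h ys) := by
  simp only [codeOut, Finset.sum_mul]
  rw [Finset.sum_comm]
  refine Finset.sum_congr rfl fun c _ => ?_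
  simp only [mul_assoc, ← Finset.mul_sum, Finset.sum_mul]
  rw [Finset.sum_comm]

/-- Nonasymptotic converse bound. -/
theorem log_mul_one_sub_codeErr_le {W : X → Y → ℝ} {x0 : X} (hW : ∀ x, IsDist (W x))
    (hsupp : ∀ y, 0 < W x0 y) {g : Y → ℝ}
    (hg : ∀ x, relEnt (W x) (W x0) = -∑ y, W x y * g y) (hm : 0 < m)
    {ρ : (Fin m → Fin n → X) × ((Fin n → Y) → Fin m) → ℝ} (hρ : IsDist ρ) {δ t a : ℝ}
    (hδ : relEnt (codeOut W ρ) (fun ys : Fin n → Y => ∏ i, W x0 (ys i)) ≤ δ) (ht : 0 < t)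
    (hmgf : ∑ y, W x0 y * Real.exp (-(t * g y) - a) ≤ 1) :
    Real.log m * (1 - codeErr W ρ) ≤ 1 + (δ + n * a) / t := by
  have hq : IsDist fun ys : Fin n → Y => ∏ i, W x0 (ys i) := isDist_prod fun _ => hW x0
  have hq0 : ∀ ys : Fin n → Y, 0 < ∏ i, W x0 (ys i) := fun ys =>
    Finset.prod_pos fun i _ => hsupp _
  have hfano : Real.log m * (1 - codeErr W ρ)
      ≤ -∑ ys, codeOut W ρ ys * (∑ i, g (ys i)) + 1 := by
    have h := Finset.sum_le_sum fun c (_ : c ∈ Finset.univ) =>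
      mul_le_mul_of_nonneg_left (log_mul_one_sub_le_relEnt hW hm hq hq0 c) (hρ.1 c)
    calc Real.log m * (1 - codeErr W ρ) = _ := by
          simp only [mul_left_comm (ρ _) (Real.log m), ← Finset.mul_sum]
          simp only [mul_sub, mul_one, Finset.sum_sub_distrib, hρ.2, codeErr]
      _ ≤ _ := h
      _ = _ := by
          simp only [mul_add, Finset.sum_add_distrib, mul_one, hρ.2]
          rw [sum_codeOut_mul, ← Finset.sum_neg_distrib]
          congr 1
          refine Finset.sum_congr rfl fun c _ => ?_
          simp only [relEnt_prod_eq (fun i => hW (c.1 _ i)) hsupp (fun i => hg (c.1 _ i)),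
            Finset.sum_neg_distrib, mul_neg]
  have hdv := sum_mul_le_relEnt_add (isDist_codeOut hW hm hρ) hq0
    fun ys => ∑ i, (-(t * g (ys i)) - a)
  have hone := sum_prod_mul_exp_le_one (n := n) hsupp hmgf
  have hlin : ∑ ys, codeOut W ρ ys * ∑ i, (-(t * g (ys i)) - a)
      = t * (-∑ ys, codeOut W ρ ys * (∑ i, g (ys i))) - n * a := by
    have : ∀ ys : Fin n → Y, codeOut W ρ ys * ∑ i, (-(t * g (ys i)) - a)
        = t * (-(codeOut W ρ ys * (∑ i, g (ys i)))) - codeOut W ρ ys * (n * a) := by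
      intro ys
      simp only [Finset.sum_sub_distrib, Finset.sum_neg_distrib, ← Finset.mul_sum,
        Finset.sum_const, Finset.card_univ, Fintype.card_fin, nsmul_eq_mul]
      ring
    rw [Finset.sum_congr rfl fun ys _ => this ys, Finset.sum_sub_distrib, ← Finset.mul_sum,
      ← Finset.sum_mul, (isDist_codeOut hW hm hρ).2, Finset.sum_neg_distrib, one_mul]
  have hfin : -∑ ys, codeOut W ρ ys * (∑ i, g (ys i)) ≤ (δ + n * a) / t := by
    rw [le_div_iff₀ ht]
    linarith
  linarith

/-- Asymptotic converse bound at a fixed error probability. -/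
theorem eventually_Kmax_div_sqrt_le {W : X → Y → ℝ} {x0 : X} (hW : ∀ x, IsDist (W x))
    (hsupp : ∀ y, 0 < W x0 y) {g : Y → ℝ}
    (hg : ∀ x, relEnt (W x) (W x0) = -∑ y, W x y * g y) (hg0 : ∑ y, W x0 y * g y = 0)
    {δ ε : ℝ} (hδ : 0 < δ) (hε : 0 < ε) (hε1 : ε < 1) :
    ∀ᶠ n : ℕ in atTop, Kmax W x0 δ ε n / Real.sqrt (n * δ)
      ≤ (ε + Real.sqrt (2 * (∑ y, W x0 y * g y ^ 2 + ε))) / (1 - ε) := by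
  set V := ∑ y, W x0 y * g y ^ 2
  have hV : 0 ≤ V := Finset.sum_nonneg fun y _ => mul_nonneg (hsupp y).le (sq_nonneg _)
  set r := Real.sqrt (2 * (V + ε)) with hr
  have hrpos : 0 < r := Real.sqrt_pos.2 (by positivity)
  have hr2 : r ^ 2 = 2 * (V + ε) := Real.sq_sqrt (by positivity)
  have hs : Tendsto (fun n : ℕ => Real.sqrt (n * δ)) atTop atTop :=
    Real.tendsto_sqrt_atTop.comp (tendsto_natCast_atTop_atTop.atTop_mul_const hδ)
  have ht : Tendsto (fun n : ℕ => 2 * δ / r / Real.sqrt (n * δ)) atTop (𝓝 0) :=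
    hs.const_div_atTop _
  filter_upwards [ht.eventually (eventually_sum_mul_exp_le_one (hW x0) hg0 hε),
    hs.eventually_ge_atTop (1 / ε)] with n hmgf hn
  set s := Real.sqrt (n * δ)
  have hspos : 0 < s := lt_of_lt_of_le (by positivity) hn
  have hs2 : s ^ 2 = n * δ := Real.sq_sqrt (by positivity)
  have h1ε : 0 < 1 - ε := by linarith
  have hsε : 1 ≤ ε * s := by
    rw [div_le_iff₀ hε] at hn
    linarith
  rw [div_le_iff₀ hspos]
  refine Real.sSup_le ?_ (by positivity)
  rintro k ⟨m, hm, ρ, hρ0, hρ1, hD, herr, rfl⟩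
  have h := log_mul_one_sub_codeErr_le hW hsupp hg hm ⟨hρ0, hρ1⟩ hD (by positivity) hmgf
  have hval : (δ + n * ((2 * δ / r / s) ^ 2 * (V + ε) / 2)) / (2 * δ / r / s) = r * s := by
    have hVε : V + ε = r ^ 2 / 2 := by linarith
    have hnn : (n : ℝ) = s ^ 2 / δ := by field_simp; linarith
    rw [hVε, hnn]
    field_simp
    ring
  rw [hval] at h
  have hlog : 0 ≤ Real.log m := Real.log_natCast_nonneg m
  have h2 : Real.log m * (1 - ε) ≤ Real.log m * (1 - codeErr W ρ) :=
    mul_le_mul_of_nonneg_left (by linarith) hlog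
  rw [div_mul_eq_mul_div, le_div_iff₀ h1ε]
  linarith

end Code

/-!
STATEMENT 6: If there is a capacity-achieving input distribution `P*` using all input
symbols, with capacity-achieving output distribution `Q* = P*W`, then
`L ≤ √(2 · var_{Q0}(log(Q0(Y)/Q*(Y))))`.
-/

theorem statement6 {X Y : Type*} [Fintype X] [Fintype Y] [DecidableEq Y]
    (W : X → Y → ℝ) (x0 : X) (hW : ∀ x, IsDist (W x)) (hsupp : ∀ y, 0 < W x0 y)
    (Pstar : X → ℝ) (hPstar : IsDist Pstar) (hfull : ∀ x, 0 < Pstar x)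
    (hcap : ∀ P : X → ℝ, IsDist P → mutInfo P W ≤ mutInfo Pstar W)
    (δ : ℝ) (hδ : 0 < δ) (L : EReal) (hL : IsL W x0 δ L) :
    L ≤ ((Real.sqrt (2 * varFin (W x0)
      (fun y => Real.log (W x0 y / outDist Pstar W y))) : ℝ) : EReal) := by
  have hpos := outDist_pos hW hsupp hPstar (hfull x0)
  have hkkt : ∀ x, relEnt (W x) (outDist Pstar W) = mutInfo Pstar W := fun x =>
    relEnt_eq_mutInfo_of_forall_le hW hPstar hpos hcap (hfull x)
  set f : Y → ℝ := fun y => Real.log (W x0 y / outDist Pstar W y) with hf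
  have hmean : ∑ y, W x0 y * f y = mutInfo Pstar W := hkkt x0
  have hlin : ∀ x, ∑ y, W x y * (f y - ∑ a, W x0 a * f a)
      = (∑ y, W x y * f y) - mutInfo Pstar W := by
    intro x
    simp only [hmean, mul_sub, Finset.sum_sub_distrib, ← Finset.sum_mul, (hW x).2, one_mul]
  have hg : ∀ x, relEnt (W x) (W x0) = -∑ y, W x y * (f y - ∑ a, W x0 a * f a) := by
    intro x
    have h := relEnt_eq_relEnt_add (W x) hsupp hpos
    rw [hkkt x] at h
    rw [hlin x, h]
    ring
  have hg0 : ∑ y, W x0 y * (f y - ∑ a, W x0 a * f a) = 0 := by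
    rw [hlin, hmean, sub_self]
  have hlim : Tendsto (fun ε : ℝ =>
      (((ε + Real.sqrt (2 * (varFin (W x0) f + ε))) / (1 - ε) : ℝ) : EReal))
      (𝓝[>] 0) (𝓝 ((Real.sqrt (2 * varFin (W x0) f) : ℝ) : EReal)) := by
    refine (continuous_coe_real_ereal.tendsto _).comp ?_
    refine tendsto_nhdsWithin_of_tendsto_nhds ?_
    have hc : ContinuousAt
        (fun ε : ℝ => (ε + Real.sqrt (2 * (varFin (W x0) f + ε))) / (1 - ε)) 0 :=
      ContinuousAt.div (by fun_prop) (by fun_prop) (by norm_num)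
    simpa [ContinuousAt] using hc
  refine le_of_tendsto_of_tendsto hL hlim ?_
  filter_upwards [Ioo_mem_nhdsGT (zero_lt_one' ℝ)] with ε hε
  refine liminf_le_of_frequently_le' (Eventually.frequently ?_)
  filter_upwards [eventually_Kmax_div_sqrt_le hW hsupp hg hg0 hδ hε.1 hε.2] with n hn
  exact EReal.coe_le_coe_iff.2 hn
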